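/- arXiv:2512.11535 — 2 statements merged into one kernel-verified Lean document; each statement's English description precedes it below -/
import Mathlib

section
/- Let H be a finite simple graph on a vertex set V, let S ⊆ V be an independent set of H, and let x, y ∈ V \ S be distinct. Let G be a simple graph on the vertex set V \ S such that: (i) every edge of H joining two vertices of V \ S is an edge of G, and (ii) for every s ∈ S and every two distinct neighbors a, b of s in H with a, b ∈ V \ S, the pair ab is an edge of G. If H has a Hamiltonian path from x to y, then G has a Hamiltonian path from x to y. -/
open Classical in
/-- A path of `H` with endpoints outside the independent set `S` can be shortcut to a walk of `G`
that visits exactly the vertices of the path outside `S`, in the same order. -/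
theorem SimpleGraph.Walk.IsPath.exists_walk_support_eq_filter {V : Type*} {H : SimpleGraph V}
    {S : Set V} (hS : ∀ a ∈ S, ∀ b ∈ S, ¬ H.Adj a b) {G : SimpleGraph {v : V // v ∉ S}}
    (h1 : ∀ a b : {v : V // v ∉ S}, H.Adj (a : V) (b : V) → G.Adj a b)
    (h2 : ∀ s ∈ S, ∀ a b : {v : V // v ∉ S}, a ≠ b →
      H.Adj s (a : V) → H.Adj s (b : V) → G.Adj a b) :
    ∀ {x y : V} (hx : x ∉ S) (hy : y ∉ S) {p : H.Walk x y}, p.IsPath → ∃ q : G.Walk ⟨x, hx⟩ ⟨y, hy⟩,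
      q.support.map Subtype.val = p.support.filter (· ∉ S)
  | _, _, hx, _, .nil, _ => ⟨.nil, by simp [hx]⟩
  | x, y, hx, hy, .cons hxy .nil, _ => ⟨(h1 ⟨x, hx⟩ ⟨y, hy⟩ hxy).toWalk, by simp [hx, hy]⟩
  | x, y, hx, hy, .cons (v := c) hxc (.cons (v := d) hcd p), hp => by
    rw [SimpleGraph.Walk.cons_isPath_iff] at hp
    by_cases hc : c ∈ S
    · have hd : d ∉ S := fun hd => hS c hc d hd hcd
      have hxd : x ≠ d := by
        rintro rfl
        exact hp.2 (by simp)
      obtain ⟨q, hq⟩ := exists_walk_support_eq_filter hS h1 h2 hd hy hp.1.of_cons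
      have hadj : G.Adj ⟨x, hx⟩ ⟨d, hd⟩ :=
        h2 c hc _ _ (fun h => hxd (congrArg Subtype.val h)) hxc.symm hcd
      exact ⟨.cons hadj q, by simp [hq, hx, hc]⟩
    · obtain ⟨q, hq⟩ := exists_walk_support_eq_filter hS h1 h2 hc hy hp.1
      exact ⟨.cons (h1 ⟨x, hx⟩ ⟨c, hc⟩ hxc) q, by simp [hq, hx]⟩
termination_by _ _ _ _ p => p.length


/-- Suppressing an independent set `S` along a Hamiltonian path: if every edge of `H`
avoiding `S` is an edge of `G`, and for every `s ∈ S` any two distinct neighbors of `s`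
outside `S` are adjacent in `G`, then a Hamiltonian path of `H` between two vertices
`x, y ∉ S` yields a Hamiltonian path of `G` between `x` and `y`. -/
theorem stmt_3 {V : Type*} [Fintype V] [DecidableEq V] (H : SimpleGraph V) (S : Set V)
    (hS : ∀ a ∈ S, ∀ b ∈ S, ¬ H.Adj a b)
    (G : SimpleGraph {v : V // v ∉ S})
    (h1 : ∀ a b : {v : V // v ∉ S}, H.Adj (a : V) (b : V) → G.Adj a b)
    (h2 : ∀ s ∈ S, ∀ a b : {v : V // v ∉ S}, a ≠ b →
      H.Adj s (a : V) → H.Adj s (b : V) → G.Adj a b)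
    (x y : V) (hx : x ∉ S) (hy : y ∉ S) (hxy : x ≠ y)
    (hp : ∃ p : H.Walk x y, p.IsHamiltonian) :
    ∃ q : G.Walk ⟨x, hx⟩ ⟨y, hy⟩, q.IsHamiltonian := by
  obtain ⟨p, hp⟩ := hp
  obtain ⟨q, hq⟩ := hp.isPath.exists_walk_support_eq_filter hS h1 h2 hx hy
  have hq_path : q.IsPath := by
    rw [SimpleGraph.Walk.isPath_def]
    exact List.Nodup.of_map Subtype.val (hq ▸ hp.isPath.support_nodup.filter _)
  refine ⟨q, hq_path.isHamiltonian_of_mem fun v => ?_⟩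
  rw [← List.mem_map_of_injective Subtype.val_injective, hq]
  simpa using ⟨hp.mem_support v, v.2⟩
end

section
/- Let H be a finite simple graph on a vertex set V and let S ⊆ V be an independent set of H with |V \ S| ≥ 3. Let G be a simple graph on the vertex set V \ S such that: (i) every edge of H joining two vertices of V \ S is an edge of G, and (ii) for every s ∈ S and every two distinct neighbors a, b of s in H with a, b ∈ V \ S, the pair ab is an edge of G. If H has a Hamiltonian cycle, then G has a Hamiltonian cycle. -/
namespace SimpleGraph

/-- Suppressing an independent set `S` along a path `q` of `H` that ends outside `S`. -/
theorem Walk.IsPath.exists_walk_support_eq_filter_s4 {V : Type*} {H : SimpleGraph V} {S : Set V}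
    [DecidablePred (· ∈ S)]
    (hS : ∀ a ∈ S, ∀ b ∈ S, ¬ H.Adj a b)
    {G : SimpleGraph {v : V // v ∉ S}}
    (h1 : ∀ a b : {v : V // v ∉ S}, H.Adj (a : V) (b : V) → G.Adj a b)
    (h2 : ∀ s ∈ S, ∀ a b : {v : V // v ∉ S}, a ≠ b →
      H.Adj s (a : V) → H.Adj s (b : V) → G.Adj a b)
    {u w : V} {q : H.Walk u w} (hq : q.IsPath) (hw : w ∉ S) :
    ∃ c : {v : V // v ∉ S}, (u = c ∨ u ∈ S ∧ H.Adj u c) ∧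
      ∃ r : G.Walk c ⟨w, hw⟩, r.support.map Subtype.val = q.support.filter (· ∉ S) := by
  induction q with
  | nil => exact ⟨⟨_, hw⟩, .inl rfl, .nil, by simp [hw]⟩
  | @cons x u w h q ih =>
    rw [Walk.cons_isPath_iff] at hq
    obtain ⟨c, hc, r, hr⟩ := ih hq.1 hw
    by_cases hx : x ∈ S
    · have hu : u = c := hc.resolve_right fun hu ↦ hS x hx u hu.1 h
      exact ⟨c, .inr ⟨hx, hu ▸ h⟩, r, by simp [hx, hr]⟩
    · have hmem : (c : V) ∈ q.support := by
        have : (c : V) ∈ r.support.map Subtype.val := List.mem_map_of_mem r.start_mem_support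
        rw [hr] at this
        exact List.mem_of_mem_filter this
      have hadj : G.Adj ⟨x, hx⟩ c := by
        rcases hc with rfl | ⟨hu, huc⟩
        · exact h1 _ _ h
        · refine h2 u hu _ _ ?_ h.symm huc
          rintro rfl
          exact hq.2 hmem
      exact ⟨⟨x, hx⟩, .inl rfl, .cons hadj r, by simp [hx, hr]⟩

end SimpleGraph

/-- Suppressing an independent set `S` along a Hamiltonian cycle: if every edge of `H`
avoiding `S` is an edge of `G`, for every `s ∈ S` any two distinct neighbors of `s`
outside `S` are adjacent in `G`, and there are at least three vertices outside `S`,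
then `H` Hamiltonian implies `G` Hamiltonian. -/
theorem stmt_4 {V : Type*} [Fintype V] [DecidableEq V] (H : SimpleGraph V) (S : Set V)
    [DecidablePred (· ∈ S)]
    (hS : ∀ a ∈ S, ∀ b ∈ S, ¬ H.Adj a b)
    (G : SimpleGraph {v : V // v ∉ S})
    (h1 : ∀ a b : {v : V // v ∉ S}, H.Adj (a : V) (b : V) → G.Adj a b)
    (h2 : ∀ s ∈ S, ∀ a b : {v : V // v ∉ S}, a ≠ b →
      H.Adj s (a : V) → H.Adj s (b : V) → G.Adj a b)
    (hcard : 3 ≤ Fintype.card {v : V // v ∉ S})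
    (hH : H.IsHamiltonian) :
    G.IsHamiltonian := by
  intro _
  have : Nontrivial {v : V // v ∉ S} := Fintype.one_lt_card_iff_nontrivial.mp (by lia)
  have : Nontrivial V := Subtype.val_injective.nontrivial (α := {v : V // v ∉ S})
  obtain ⟨a⟩ : Nonempty {v : V // v ∉ S} := inferInstance
  obtain ⟨p, hp⟩ := hH.exists_isHamiltonianCycle (a : V)
  have hq := hp.isHamiltonian_tail
  obtain ⟨c, hc, r, hr⟩ := hq.isPath.exists_walk_support_eq_filter_s4 hS h1 h2 a.2
  have hrham : r.IsHamiltonian := by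
    have hr_path : r.IsPath :=
      .mk' <| .of_map Subtype.val <| hr ▸ hq.isPath.support_nodup.filter _
    refine hr_path.isHamiltonian_of_mem fun v ↦ ?_
    have hv : (v : V) ∈ r.support.map Subtype.val := by
      rw [hr]
      exact List.mem_filter.mpr ⟨hq.mem_support _, by simpa using v.2⟩
    exact (List.mem_map_of_injective Subtype.val_injective).mp hv
  have hlen := hrham.length_eq
  have hadj : H.Adj a p.snd := p.adj_snd hp.not_nil
  have hac : G.Adj a c := by
    rcases hc with hc | ⟨hs, hsc⟩
    · exact h1 _ _ (hc ▸ hadj)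
    · refine h2 _ hs _ _ ?_ hadj.symm hsc
      rintro rfl
      have := (SimpleGraph.Walk.isPath_iff_nil.mp hrham.isPath).length_eq_zero
      lia
  refine ⟨a, .cons hac r, ?_⟩
  rw [SimpleGraph.Walk.isHamiltonianCycle_iff_isCycle_and_length_eq,
    SimpleGraph.Walk.cons_isCycle_iff]
  refine ⟨⟨hrham.isPath, fun he ↦ ?_⟩, by rw [SimpleGraph.Walk.length_cons]; lia⟩
  have := hrham.isPath.length_eq_one_of_mem_edges (Sym2.eq_swap ▸ he)
  lia
end
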